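/- arXiv:1001.5433 — 2 statements merged into one kernel-verified Lean document; each statement's English description precedes it below -/
import Mathlib

section
/- Let A → B be a faithfully flat homomorphism of noetherian local rings. If B is regular, then A is regular. -/
universe u

/-- A local ring `A` is *regular* if its maximal ideal can be generated by
`dim A` elements, where `dim A` is the Krull dimension of `A`. -/
def IsRegularLocal (A : Type u) [CommRing A] : Prop :=
  ∃ _ : IsLocalRing A, ∃ s : Finset A,
    Ideal.span (s : Set A) = IsLocalRing.maximalIdeal A ∧
      (s.card : WithBot ℕ∞) = ringKrullDim A

open CategoryTheory IsLocalRing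
open scoped Pointwise TensorProduct

/-- `M` has projective dimension less than `n` over `R`. -/
abbrev HasPD (R : Type u) [CommRing R] (M : Type u) [AddCommGroup M] [Module R M] (n : ℕ) : Prop :=
  HasProjectiveDimensionLT (ModuleCat.of R M) n

namespace HasPD

section

variable {R : Type u} [CommRing R] {K F M : Type u} [AddCommGroup K] [Module R K]
  [AddCommGroup F] [Module R F] [AddCommGroup M] [Module R M]

theorem zero_iff : HasPD R M 0 ↔ Subsingleton M := by
  rw [HasPD, hasProjectiveDimensionLT_zero_iff_isZero, ModuleCat.isZero_iff_subsingleton]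

theorem one_iff : HasPD R M 1 ↔ Module.Projective R M := by
  rw [HasPD, ← projective_iff_hasProjectiveDimensionLT_one, IsProjective.iff_projective]

theorem mono {n m : ℕ} (h : n ≤ m) (hM : HasPD R M n) : HasPD R M m :=
  hasProjectiveDimensionLT_of_ge _ n m h

theorem shortExact {f : K →ₗ[R] F} {g : F →ₗ[R] M} (hf : Function.Injective f)
    (hfg : Function.Exact f g) (hg : Function.Surjective g) :
    (ShortComplex.mk (ModuleCat.ofHom f) (ModuleCat.ofHom g)
      (by ext x; exact hfg.apply_apply_eq_zero x)).ShortExact :=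
  ModuleCat.shortComplex_shortExact _ hfg hf hg

theorem succ_iff {f : K →ₗ[R] F} {g : F →ₗ[R] M} (hf : Function.Injective f)
    (hfg : Function.Exact f g) (hg : Function.Surjective g) [Module.Projective R F] (n : ℕ) :
    HasPD R M (n + 2) ↔ HasPD R K (n + 1) :=
  (shortExact hf hfg hg).hasProjectiveDimensionLT_X₃_iff n
    ((IsProjective.iff_projective F).1 inferInstance)

theorem left {f : K →ₗ[R] F} {g : F →ₗ[R] M} (hf : Function.Injective f)
    (hfg : Function.Exact f g) (hg : Function.Surjective g) {n : ℕ}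
    (hF : HasPD R F n) (hM : HasPD R M (n + 1)) : HasPD R K n :=
  (shortExact hf hfg hg).hasProjectiveDimensionLT_X₁ n hF hM

theorem of_leftInverse {n : ℕ} (i : M →ₗ[R] F) (r : F →ₗ[R] M) (h : r ∘ₗ i = LinearMap.id)
    (hF : HasPD R F n) : HasPD R M n :=
  Retract.hasProjectiveDimensionLT (X := ModuleCat.of R M) (Y := ModuleCat.of R F)
    ⟨ModuleCat.ofHom i, ModuleCat.ofHom r, by ext x; exact LinearMap.congr_fun h x⟩ n

end

/-- A finite free cover with its syzygy. -/
theorem exists_syzygy (R M : Type u) [CommRing R] [IsNoetherianRing R] [AddCommGroup M]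
    [Module R M] [Module.Finite R M] :
    ∃ (F : Type u) (_ : AddCommGroup F) (_ : Module R F) (_ : Module.Free R F)
      (_ : Module.Finite R F) (K : Submodule R F) (g : F →ₗ[R] M),
      Function.Exact K.subtype g ∧ Function.Surjective g := by
  obtain ⟨F, _, _, _, _, g, hg⟩ := Module.exists_finite_presentation R M
  exact ⟨F, _, _, inferInstance, inferInstance, LinearMap.ker g, g,
    g.exact_subtype_ker_map, hg⟩

end HasPD

theorem isLocalRing_quotient_span_singleton {R : Type u} [CommRing R] [IsLocalRing R] {x : R}
    (hx : x ∈ maximalIdeal R) :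
    IsLocalRing (R ⧸ Ideal.span {x}) := by
  have : Nontrivial (R ⧸ Ideal.span {x}) :=
    Ideal.Quotient.nontrivial_iff.2 fun h => by
      have := (Ideal.span_singleton_le_iff_mem _).2 hx
      rw [h, top_le_iff] at this
      exact Ideal.IsPrime.ne_top' this
  exact .of_surjective' _ Ideal.Quotient.mk_surjective

namespace HasPD

theorem shortExact_quotSMulTop {R K F M : Type u} [CommRing R] [AddCommGroup K] [Module R K]
    [AddCommGroup F] [Module R F] [AddCommGroup M] [Module R M] {x : R}
    {f : K →ₗ[R] F} {g : F →ₗ[R] M} (hf : Function.Injective f)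
    (hfg : Function.Exact f g) (hg : Function.Surjective g) (hx : IsSMulRegular M x) :
    ∃ (f' : QuotSMulTop x K →ₗ[R ⧸ Ideal.span {x}] QuotSMulTop x F)
      (g' : QuotSMulTop x F →ₗ[R ⧸ Ideal.span {x}] QuotSMulTop x M),
      Function.Injective f' ∧ Function.Exact f' g' ∧ Function.Surjective g' := by
  refine ⟨(QuotSMulTop.map x f).extendScalarsOfSurjective Ideal.Quotient.mk_surjective,
    (QuotSMulTop.map x g).extendScalarsOfSurjective Ideal.Quotient.mk_surjective, ?_,
    QuotSMulTop.map_exact x hfg hg, QuotSMulTop.map_surjective x hg⟩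
  have h0 : Function.Exact (0 : PUnit.{u + 1} →ₗ[R] K) f := by
    intro k
    simp [map_eq_zero_iff f hf, eq_comm]
  have := QuotSMulTop.map_first_exact_on_four_term_exact_of_isSMulRegular_last h0 hfg hx
  refine (injective_iff_map_eq_zero' (QuotSMulTop.map x f)).2 fun k => ?_
  rw [this k, map_zero]
  simp [eq_comm]

/-- Projective dimension is preserved by reduction modulo a regular element. -/
theorem quotSMulTop_iff {R : Type u} [CommRing R] [IsLocalRing R] [IsNoetherianRing R] {x : R}
    (hx : x ∈ maximalIdeal R) (hxR : IsRegular x) (n : ℕ) :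
    ∀ (M : Type u) [AddCommGroup M] [Module R M] [Module.Finite R M], IsSMulRegular M x →
      (HasPD (R ⧸ Ideal.span {x}) (QuotSMulTop x M) n ↔ HasPD R M n) := by
  have := isLocalRing_quotient_span_singleton hx
  have hjac : x ∈ (⊥ : Ideal R).jacobson := by
    rwa [IsLocalRing.jacobson_eq_maximalIdeal _ bot_ne_top]
  induction n with
  | zero =>
    intro M _ _ _ hM
    rw [zero_iff, zero_iff]
    constructor
    · intro h
      by_contra hc
      rw [not_subsingleton_iff_nontrivial] at hc
      have := nontrivial_quotSMulTop_of_mem_maximalIdeal M hx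
      exact not_subsingleton _ h
    · intro h
      exact (Submodule.mkQ_surjective _).subsingleton
  | succ n ih =>
    intro M _ _ _ hM
    have := Module.Finite.of_restrictScalars_finite R (R ⧸ Ideal.span {x}) (QuotSMulTop x M)
    cases n with
    | zero =>
      rw [one_iff, one_iff]
      have := Module.finitePresentation_of_finite R M
      have key := Module.free_quotSMulTop_iff_free (R := R) M hjac hM
      constructor
      · intro h
        have := key.1 Module.free_of_flat_of_isLocalRing
        infer_instance
      · intro h
        have := key.2 Module.free_of_flat_of_isLocalRing
        infer_instance
    | succ n =>
      obtain ⟨F, _, _, _, _, K, g, hKg, hg⟩ := exists_syzygy R M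
      have hF : IsSMulRegular F x := Module.Flat.isSMulRegular_of_isRegular hxR
      have hK : IsSMulRegular K x := hF.submodule K x
      obtain ⟨f', g', hf', hfg', hg'⟩ :=
        shortExact_quotSMulTop K.subtype_injective hKg hg hM
      rw [succ_iff K.subtype_injective hKg hg, succ_iff hf' hfg' hg']
      exact ih K hK

theorem of_baseChange {A B : Type u} [CommRing A] [CommRing B] [Algebra A B] [IsNoetherianRing A]
    [Module.FaithfullyFlat A B] (n : ℕ) :
    ∀ (M : Type u) [AddCommGroup M] [Module A M] [Module.Finite A M],
      HasPD B (B ⊗[A] M) n → HasPD A M n := by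
  induction n with
  | zero =>
    intro M _ _ _
    rw [zero_iff, zero_iff]
    intro h
    exact Module.FaithfullyFlat.lTensor_reflects_triviality A B M
  | succ n ih =>
    intro M _ _ _
    cases n with
    | zero =>
      rw [one_iff, one_iff]
      intro h
      have := Module.finitePresentation_of_finite A M
      have : Module.Flat A M := Module.Flat.of_flat_tensorProduct A M B
      exact Module.Flat.projective_of_finitePresentation
    | succ n =>
      obtain ⟨F, _, _, _, _, K, g, hKg, hg⟩ := exists_syzygy A M
      rw [succ_iff K.subtype_injective hKg hg,
        succ_iff (f := K.subtype.baseChange B) (g := g.baseChange B)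
          (Module.Flat.lTensor_preserves_injective_linearMap K.subtype K.subtype_injective)
          (lTensor_exact B hKg hg) (LinearMap.lTensor_surjective B hg)]
      exact ih K

/-- If the residue field of a noetherian local ring embeds into the ring, then finite modules of
finite projective dimension are free. -/
theorem free_of_injective {R : Type u} [CommRing R] [IsLocalRing R] [IsNoetherianRing R]
    (j : ResidueField R →ₗ[R] R) (hj : Function.Injective j) (n : ℕ) :
    ∀ (M : Type u) [AddCommGroup M] [Module R M] [Module.Finite R M],
      HasPD R M n → Module.Free R M := by
  induction n with
  | zero =>
    intro M _ _ _ h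
    have := zero_iff.1 h
    infer_instance
  | succ n ih =>
    intro M _ _ _ h
    cases n with
    | zero =>
      have := one_iff.1 h
      exact Module.free_of_flat_of_isLocalRing
    | succ n =>
      obtain ⟨F, _, _, _, _, K, g, hKg, hg⟩ := exists_syzygy R M
      have := ih K ((succ_iff K.subtype_injective hKg hg n).1 h)
      refine Module.free_of_lTensor_residueField_injective K.subtype g hg hKg ?_
      have h1 : Function.Injective (K.subtype.lTensor R ∘ₗ j.rTensor K) :=
        (Module.Flat.lTensor_preserves_injective_linearMap K.subtype K.subtype_injective).comp
          (Module.Flat.rTensor_preserves_injective_linearMap j hj)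
      rw [LinearMap.lTensor_comp_rTensor, ← LinearMap.rTensor_comp_lTensor] at h1
      exact .of_comp h1

/-- A socle element which is a minimal generator spans a direct summand. -/
theorem residueField_of_socle {R N : Type u} [CommRing R] [IsLocalRing R] [AddCommGroup N]
    [Module R N] {z : N} (hz : ∀ r ∈ maximalIdeal R, r • z = 0)
    (hz' : z ∉ maximalIdeal R • (⊤ : Submodule R N)) {n : ℕ} (h : HasPD R N n) :
    HasPD R (ResidueField R) n := by
  let _ : Module (ResidueField R) (N ⧸ maximalIdeal R • (⊤ : Submodule R N)) :=
    inferInstanceAs (Module (R ⧸ maximalIdeal R) _)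
  have : IsScalarTower R (ResidueField R) (N ⧸ maximalIdeal R • (⊤ : Submodule R N)) :=
    inferInstanceAs (IsScalarTower R (R ⧸ maximalIdeal R) _)
  have hv : (maximalIdeal R • (⊤ : Submodule R N)).mkQ z ≠ 0 := by
    simpa [Submodule.Quotient.mk_eq_zero] using hz'
  obtain ⟨φ, hφ⟩ := Module.Projective.exists_dual_ne_zero (ResidueField R) hv
  let i : ResidueField R →ₗ[R] N := (maximalIdeal R).liftQ (LinearMap.toSpanSingleton R N z)
    fun r hr => hz r hr
  let r : N →ₗ[R] ResidueField R :=
    (((φ (Submodule.mkQ _ z))⁻¹ • φ).restrictScalars R) ∘ₗ Submodule.mkQ _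
  refine of_leftInverse i r (Submodule.linearMap_qext _ (LinearMap.ext_ring ?_)) h
  change (φ (Submodule.mkQ _ z))⁻¹ * φ (Submodule.mkQ _ ((1 : R) • z)) = 1
  rw [one_smul, inv_mul_cancel₀ hφ]

end HasPD

section Quotient

variable {R : Type u} [CommRing R] [IsLocalRing R] {x : R} [IsLocalRing (R ⧸ Ideal.span {x})]

theorem map_mk_maximalIdeal :
    (maximalIdeal R).map (Ideal.Quotient.mk (Ideal.span {x})) = maximalIdeal _ :=
  IsLocalRing.map_maximalIdeal_of_surjective _ Ideal.Quotient.mk_surjective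

variable [IsNoetherianRing R]

theorem spanFinrank_maximalIdeal_le_quotient_succ (hx : x ∈ maximalIdeal R) :
    (maximalIdeal R).spanFinrank ≤ (maximalIdeal (R ⧸ Ideal.span {x})).spanFinrank + 1 := by
  classical
  obtain ⟨s, hs, hspan⟩ := Submodule.FG.exists_span_finset_card_eq_spanFinrank
    (maximalIdeal (R ⧸ Ideal.span {x})).fg_of_isNoetherianRing
  obtain ⟨σ, hσ⟩ := (Ideal.Quotient.mk_surjective (I := Ideal.span {x})).hasRightInverse
  have hmap : (Ideal.span (s.image σ : Set R)).map (Ideal.Quotient.mk (Ideal.span {x})) =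
      maximalIdeal (R ⧸ Ideal.span {x}) := by
    rw [Ideal.map_span, Finset.coe_image, ← Set.image_comp, hσ.comp_eq_id, Set.image_id]
    exact hspan
  have key : maximalIdeal R = Submodule.span R (insert x (s.image σ) : Finset R) := by
    have h1 := congrArg (Ideal.comap (Ideal.Quotient.mk (Ideal.span {x})))
      (hmap.trans map_mk_maximalIdeal.symm)
    rw [Ideal.comap_map_of_surjective' _ Ideal.Quotient.mk_surjective,
      Ideal.comap_map_of_surjective' _ Ideal.Quotient.mk_surjective, Ideal.mk_ker,
      sup_eq_left.2 ((Ideal.span_singleton_le_iff_mem _).2 hx)] at h1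
    rw [← h1, Finset.coe_insert, sup_comm, ← Ideal.span_union]
    rfl
  rw [key]
  refine (Submodule.spanFinrank_span_le_ncard_of_finite (Finset.finite_toSet _)).trans ?_
  rw [Set.ncard_coe_finset, ← hs]
  exact (Finset.card_insert_le _ _).trans (Nat.succ_le_succ Finset.card_image_le)

theorem spanFinrank_maximalIdeal_quotient_succ_le (hx : x ∈ maximalIdeal R)
    (hx2 : x ∉ maximalIdeal R ^ 2) :
    (maximalIdeal (R ⧸ Ideal.span {x})).spanFinrank + 1 ≤ (maximalIdeal R).spanFinrank := by
  classical
  obtain ⟨s, hs, hspan⟩ := Submodule.FG.exists_span_finset_card_eq_spanFinrank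
    (maximalIdeal R).fg_of_isNoetherianRing
  have hsm : ∀ y ∈ s, y ∈ maximalIdeal R := fun y hy => hspan ▸ Submodule.subset_span hy
  obtain ⟨f, -, hf⟩ := Submodule.mem_span_finset.1 (hspan.symm ▸ hx)
  obtain ⟨y, hy, hfy⟩ : ∃ y ∈ s, IsUnit (f y) := by
    by_contra! h
    apply hx2
    rw [← hf, pow_two]
    exact Submodule.sum_mem _ fun y hy => Ideal.mul_mem_mul (h y hy) (hsm y hy)
  let q := Ideal.Quotient.mk (Ideal.span {x})
  have key : maximalIdeal (R ⧸ Ideal.span {x}) =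
      Submodule.span (R ⧸ Ideal.span {x}) ((s.erase y).image q : Finset (R ⧸ Ideal.span {x})) := by
    have h0 : maximalIdeal (R ⧸ Ideal.span {x}) = Ideal.span (q '' s) := by
      rw [← map_mk_maximalIdeal, ← hspan, ← Ideal.map_span]
    apply le_antisymm
    · rw [h0, Ideal.span_le]
      rintro _ ⟨z, hz, rfl⟩
      have hmem : ∀ z ∈ s.erase y, q z ∈ Submodule.span (R ⧸ Ideal.span {x})
          ((s.erase y).image q : Finset (R ⧸ Ideal.span {x})) := fun z hz =>
        Submodule.subset_span (Finset.mem_coe.2 (Finset.mem_image_of_mem q hz))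
      by_cases hzy : z = y
      · subst hzy
        have h1 : q (f z) * q z = - ∑ a ∈ s.erase z, q (f a) * q a := by
          have := congrArg q hf
          rw [← Finset.add_sum_erase s _ hy, Ideal.Quotient.eq_zero_iff_mem.2
            (Ideal.mem_span_singleton_self x), map_add, map_sum] at this
          simpa [eq_neg_iff_add_eq_zero] using this
        have h2 : q (f z) * q z ∈ Submodule.span (R ⧸ Ideal.span {x})
            ((s.erase z).image q : Finset (R ⧸ Ideal.span {x})) := by
          rw [h1]
          exact Submodule.neg_mem _ (Submodule.sum_mem _ fun a ha =>
            Submodule.smul_mem _ _ (hmem a ha))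
        exact (Ideal.unit_mul_mem_iff_mem _ (hfy.map q)).1 h2
      · exact hmem z (Finset.mem_erase.2 ⟨hzy, hz⟩)
    · rw [h0]
      refine Ideal.span_mono ?_
      rw [Finset.coe_image]
      exact Set.image_mono (Finset.coe_subset.2 (Finset.erase_subset _ _))
  have h1 : (maximalIdeal (R ⧸ Ideal.span {x})).spanFinrank ≤ (s.erase y).card := by
    rw [key]
    refine (Submodule.spanFinrank_span_le_ncard_of_finite (Finset.finite_toSet _)).trans ?_
    rw [Set.ncard_coe_finset]
    exact Finset.card_image_le
  rw [← hs, ← Finset.card_erase_add_one hy]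
  exact Nat.succ_le_succ h1

end Quotient

/-- Prime avoidance for the maximal ideal, its square and finitely many further primes. -/
theorem exists_mem_maximalIdeal_notMem_sq {R : Type u} [CommRing R] [IsLocalRing R]
    [IsNoetherianRing R] (hR : ¬ IsField R) {S : Set (Ideal R)} (hS : S.Finite)
    (hprime : ∀ p ∈ S, p.IsPrime) (hmem : maximalIdeal R ∉ S) :
    ∃ x ∈ maximalIdeal R, x ∉ maximalIdeal R ^ 2 ∧ ∀ p ∈ S, x ∉ p := by
  by_contra! h
  have hsub : (maximalIdeal R : Set R) ⊆
      ⋃ p ∈ insert (maximalIdeal R ^ 2) S, (p : Set R) := by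
    intro x hx
    by_cases hx2 : x ∈ maximalIdeal R ^ 2
    · exact Set.mem_biUnion (Set.mem_insert _ _) hx2
    · obtain ⟨p, hp, hxp⟩ := h x hx hx2
      exact Set.mem_biUnion (Set.mem_insert_of_mem _ hp) hxp
  obtain ⟨p, hp, hle⟩ := (Ideal.subset_union_prime_finite (hS.insert _) (f := id)
    (maximalIdeal R ^ 2) (maximalIdeal R ^ 2) fun p hp hne _ =>
      hprime p (hp.resolve_left hne)).1 hsub
  rcases hp with rfl | hp
  · exact ((maximalIdeal_sq_lt_maximalIdeal R).2 hR).not_ge hle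
  · have := hprime p hp
    exact hmem ((maximalIdeal.isMaximal R).eq_of_le this.ne_top hle ▸ hp)

namespace IsRegularLocalRing

theorem quotient_span_singleton {R : Type u} [CommRing R] [IsRegularLocalRing R] {x : R}
    (hx : x ∈ maximalIdeal R) (hx2 : x ∉ maximalIdeal R ^ 2) :
    IsRegularLocalRing (R ⧸ Ideal.span {x}) := by
  have := isLocalRing_quotient_span_singleton hx
  apply of_spanFinrank_maximalIdeal_le
  have h1 := spanFinrank_maximalIdeal_quotient_succ_le hx hx2
  have h2 := ringKrullDim_le_ringKrullDim_quotient_add_card {x}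
    (by simpa [IsLocalRing.ringJacobson_eq_maximalIdeal] using hx)
  rw [Finset.coe_singleton, Finset.card_singleton, Nat.cast_one, ← spanFinrank_maximalIdeal] at h2
  have h3 : (((maximalIdeal (R ⧸ Ideal.span {x})).spanFinrank : WithBot ℕ∞) + 1) ≤
      ringKrullDim (R ⧸ Ideal.span {x}) + 1 := le_trans (by exact_mod_cast h1) h2
  exact (WithBot.add_le_add_iff_right' (α := ℕ) (c := 1) (by decide) (by decide)).1 h3

theorem of_quotient_span_singleton {R : Type u} [CommRing R] [IsLocalRing R] [IsNoetherianRing R]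
    {x : R} (hx : x ∈ maximalIdeal R) (hreg : IsSMulRegular R x)
    [IsRegularLocalRing (R ⧸ Ideal.span {x})] : IsRegularLocalRing R := by
  apply of_spanFinrank_maximalIdeal_le
  rw [← ringKrullDim_quotient_span_singleton_succ_eq_ringKrullDim hreg hx,
    ← spanFinrank_maximalIdeal]
  exact_mod_cast spanFinrank_maximalIdeal_le_quotient_succ hx

theorem of_isField {R : Type u} [CommRing R] [IsLocalRing R] (hR : IsField R) :
    IsRegularLocalRing R := by
  let _ := hR.toField
  have : IsNoetherianRing R := inferInstance
  apply of_spanFinrank_maximalIdeal_le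
  rw [(IsLocalRing.isField_iff_maximalIdeal_eq).1 hR, Submodule.spanFinrank_bot]
  exact_mod_cast ringKrullDim_nonneg_of_nontrivial

theorem isField_of_maximalIdeal_mem_minimalPrimes {R : Type u} [CommRing R]
    [IsRegularLocalRing R] (h : maximalIdeal R ∈ minimalPrimes R) : IsField R := by
  have h1 : (maximalIdeal R).height = 0 := Ideal.height_eq_zero_iff.2 h
  have h2 := IsLocalRing.maximalIdeal_height_eq_ringKrullDim (R := R)
  rw [h1, ← spanFinrank_maximalIdeal] at h2
  rw [IsLocalRing.isField_iff_maximalIdeal_eq,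
    ← Submodule.spanFinrank_eq_zero_iff_eq_bot (maximalIdeal R).fg_of_isNoetherianRing]
  exact_mod_cast h2.symm

theorem isDomain_of_spanFinrank_le (n : ℕ) :
    ∀ (R : Type u) [CommRing R] [IsRegularLocalRing R],
      (maximalIdeal R).spanFinrank ≤ n → IsDomain R := by
  induction n with
  | zero =>
    intro R _ _ h
    rw [Nat.le_zero, Submodule.spanFinrank_eq_zero_iff_eq_bot
      (maximalIdeal R).fg_of_isNoetherianRing, ← IsLocalRing.isField_iff_maximalIdeal_eq] at h
    exact h.isDomain
  | succ n ih =>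
    intro R _ _ h
    by_cases hR : IsField R
    · exact hR.isDomain
    obtain ⟨x, hx, hx2, hxp⟩ := exists_mem_maximalIdeal_notMem_sq hR
      (minimalPrimes.finite_of_isNoetherianRing R) (fun p hp => hp.1.1)
      fun h => hR (isField_of_maximalIdeal_mem_minimalPrimes h)
    have := quotient_span_singleton hx hx2
    have := ih (R ⧸ Ideal.span {x}) (by
      have := spanFinrank_maximalIdeal_quotient_succ_le hx hx2
      omega)
    have hprime : (Ideal.span {x}).IsPrime := (Ideal.Quotient.isDomain_iff_prime _).1 this
    obtain ⟨p, hp, hpx⟩ := Ideal.exists_minimalPrimes_le (bot_le (a := Ideal.span {x}))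
    have hpp : p.IsPrime := hp.1.1
    have hle : p ≤ Ideal.span {x} • p := by
      intro y hy
      obtain ⟨a, rfl⟩ := Ideal.mem_span_singleton.1 (hpx hy)
      exact Ideal.mul_mem_mul (Ideal.mem_span_singleton_self x)
        ((hpp.mem_or_mem hy).resolve_left (hxp p hp))
    have hbot : p = ⊥ := Submodule.eq_bot_of_le_smul_of_le_jacobson_bot _ p
      p.fg_of_isNoetherianRing hle (by
        rw [IsLocalRing.jacobson_eq_maximalIdeal _ bot_ne_top]
        exact (Ideal.span_singleton_le_iff_mem _).2 hx)
    rw [hbot] at hpp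
    exact IsDomain.of_bot_isPrime R

theorem isDomain (R : Type u) [CommRing R] [IsRegularLocalRing R] : IsDomain R :=
  isDomain_of_spanFinrank_le _ R le_rfl

end IsRegularLocalRing

/-- Finitely generated modules over a regular local ring have finite projective dimension. -/
theorem IsRegularLocalRing.exists_hasPD_of_spanFinrank_le (n : ℕ) :
    ∀ (R : Type u) [CommRing R] [IsRegularLocalRing R], (maximalIdeal R).spanFinrank ≤ n →
      ∀ (M : Type u) [AddCommGroup M] [Module R M] [Module.Finite R M], ∃ k, HasPD R M k := by
  have hfield (R : Type u) [CommRing R] (hR : IsField R) (M : Type u) [AddCommGroup M]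
      [Module R M] : ∃ k, HasPD R M k := by
    let _ := hR.toField
    exact ⟨1, HasPD.one_iff.2 inferInstance⟩
  induction n with
  | zero =>
    intro R _ _ h M _ _ _
    rw [Nat.le_zero, Submodule.spanFinrank_eq_zero_iff_eq_bot
      (maximalIdeal R).fg_of_isNoetherianRing, ← IsLocalRing.isField_iff_maximalIdeal_eq] at h
    exact hfield R h M
  | succ n ih =>
    intro R _ _ h M _ _ _
    by_cases hR : IsField R
    · exact hfield R hR M
    have := IsRegularLocalRing.isDomain R
    obtain ⟨x, hx, hx2⟩ := SetLike.exists_of_lt ((maximalIdeal_sq_lt_maximalIdeal R).2 hR)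
    have hxR : IsRegular x := IsRegular.of_ne_zero (by rintro rfl; exact hx2 (zero_mem _))
    have := quotient_span_singleton hx hx2
    obtain ⟨F, _, _, _, _, K, g, hKg, hg⟩ := HasPD.exists_syzygy R M
    have := Module.Finite.of_restrictScalars_finite R (R ⧸ Ideal.span {x}) (QuotSMulTop x K)
    obtain ⟨k, hk⟩ := ih (R ⧸ Ideal.span {x}) (by
      have := spanFinrank_maximalIdeal_quotient_succ_le hx hx2
      omega) (QuotSMulTop x K)
    have hK : IsSMulRegular K x := (Module.Flat.isSMulRegular_of_isRegular hxR).submodule K x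
    exact ⟨k + 2, (HasPD.succ_iff K.subtype_injective hKg hg k).2
      (((HasPD.quotSMulTop_iff hx hxR k K hK).1 hk).mono k.le_succ)⟩

theorem HasPD.residueField_quotient {R : Type u} [CommRing R] [IsLocalRing R] [IsNoetherianRing R]
    {x : R} (hx : x ∈ maximalIdeal R) (hx2 : x ∉ maximalIdeal R ^ 2) (hxR : IsRegular x)
    [IsLocalRing (R ⧸ Ideal.span {x})] {n : ℕ} (h : HasPD R (ResidueField R) n) :
    HasPD (R ⧸ Ideal.span {x}) (ResidueField (R ⧸ Ideal.span {x})) n := by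
  have hm : HasPD R (maximalIdeal R) n := by
    cases n with
    | zero =>
      exact absurd (zero_iff.1 h) (not_subsingleton _)
    | succ n =>
      exact left (maximalIdeal R).subtype_injective (LinearMap.exact_subtype_mkQ (maximalIdeal R))
        (Submodule.mkQ_surjective _) ((one_iff.2 inferInstance).mono (by omega))
        (h.mono (n + 1).le_succ)
  have hxm : IsSMulRegular (maximalIdeal R) x :=
    (Module.Flat.isSMulRegular_of_isRegular hxR).submodule (maximalIdeal R) x
  let φ : QuotSMulTop x (maximalIdeal R) →ₗ[R] R ⧸ maximalIdeal R ^ 2 :=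
    Submodule.liftQ _ ((Submodule.mkQ (maximalIdeal R ^ 2)) ∘ₗ (maximalIdeal R).subtype) (by
      rintro _ ⟨y, -, rfl⟩
      refine (Submodule.Quotient.mk_eq_zero _).2 ?_
      rw [pow_two]
      exact Ideal.mul_mem_mul hx y.2)
  have hmem : ∀ r ∈ maximalIdeal (R ⧸ Ideal.span {x}), ∃ a ∈ maximalIdeal R,
      Ideal.Quotient.mk (Ideal.span {x}) a = r := fun r hr => by
    rwa [← map_mk_maximalIdeal,
      Ideal.mem_map_iff_of_surjective _ Ideal.Quotient.mk_surjective] at hr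
  refine residueField_of_socle (z := Submodule.Quotient.mk ⟨x, hx⟩) ?_ ?_
    ((quotSMulTop_iff hx hxR n _ hxm).2 hm)
  · intro r hr
    obtain ⟨a, ha, rfl⟩ := hmem r hr
    change (Submodule.Quotient.mk (a • ⟨x, hx⟩) : QuotSMulTop x (maximalIdeal R)) = 0
    rw [Submodule.Quotient.mk_eq_zero]
    exact ⟨⟨a, ha⟩, trivial, Subtype.ext (mul_comm x a)⟩
  · intro hz
    have h0 : ∀ z ∈ maximalIdeal (R ⧸ Ideal.span {x}) •
        (⊤ : Submodule (R ⧸ Ideal.span {x}) (QuotSMulTop x (maximalIdeal R))), φ z = 0 := by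
      intro z hz
      refine Submodule.smul_induction_on hz ?_ fun a b ha hb => by rw [map_add, ha, hb, add_zero]
      intro r hr y _
      obtain ⟨a, ha, rfl⟩ := hmem r hr
      obtain ⟨y, rfl⟩ := Submodule.Quotient.mk_surjective _ y
      change (Submodule.Quotient.mk (a * y) : R ⧸ maximalIdeal R ^ 2) = 0
      rw [Submodule.Quotient.mk_eq_zero, pow_two]
      exact Ideal.mul_mem_mul ha y.2
    exact hx2 ((Submodule.Quotient.mk_eq_zero _).1 (h0 _ hz))

theorem IsRegularLocalRing.of_hasPD_residueField_of_spanFinrank_le {k : ℕ} (n : ℕ) :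
    ∀ (R : Type u) [CommRing R] [IsLocalRing R] [IsNoetherianRing R],
      (maximalIdeal R).spanFinrank ≤ n → HasPD R (ResidueField R) k → IsRegularLocalRing R := by
  induction n with
  | zero =>
    intro R _ _ _ h _
    rw [Nat.le_zero, Submodule.spanFinrank_eq_zero_iff_eq_bot
      (maximalIdeal R).fg_of_isNoetherianRing, ← IsLocalRing.isField_iff_maximalIdeal_eq] at h
    exact of_isField h
  | succ n ih =>
    intro R _ _ _ h hk
    by_cases hR : IsField R
    · exact of_isField hR
    have hass : maximalIdeal R ∉ associatedPrimes R R := by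
      intro hmem
      obtain ⟨j, hj⟩ := ((isAssociatedPrime_iff_exists_injective_linearMap _ _).1 hmem).2
      have hfree := HasPD.free_of_injective j hj k (ResidueField R) hk
      have : Nontrivial (ResidueField R) := (ResidueField.field R).toNontrivial
      have := Module.Free.instFaithfulSMulOfNontrivial R (ResidueField R)
      apply hR
      rw [IsLocalRing.isField_iff_maximalIdeal_eq, eq_bot_iff]
      intro r hr
      refine (Submodule.mem_bot R).2 (FaithfulSMul.eq_of_smul_eq_smul (M := R)
        (α := ResidueField R) fun a => ?_)
      rw [zero_smul, Algebra.smul_def, ResidueField.algebraMap_eq,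
        (residue_eq_zero_iff r).2 hr, zero_mul]
    obtain ⟨x, hx, hx2, hxp⟩ := exists_mem_maximalIdeal_notMem_sq hR
      (associatedPrimes.finite R R) (fun p hp => hp.isPrime) hass
    have hreg : IsSMulRegular R x := by
      by_contra hc
      have : x ∈ ⋃ p ∈ associatedPrimes R R, (p : Set R) := by
        rw [biUnion_associatedPrimes_eq_compl_regular]
        exact hc
      simp only [Set.mem_iUnion] at this
      obtain ⟨p, hp, hxp'⟩ := this
      exact hxp p hp hxp'
    have hxR : IsRegular x := Commute.isRegular_iff (mul_comm x) |>.2 (isLeftRegular_iff.2 hreg)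
    have := isLocalRing_quotient_span_singleton hx
    have := ih (R ⧸ Ideal.span {x}) (by
      have := spanFinrank_maximalIdeal_quotient_succ_le hx hx2
      omega) (hk.residueField_quotient hx hx2 hxR)
    exact of_quotient_span_singleton hx hreg

/-- If `A → B` is a faithfully flat homomorphism of noetherian local rings
(flat and surjective on prime spectra) and `B` is regular, then `A` is regular. -/
theorem isRegularLocal_of_faithfullyFlat {A B : Type u} [CommRing A] [CommRing B]
    [IsLocalRing A] [IsLocalRing B] [IsNoetherianRing A] [IsNoetherianRing B]
    (f : A →+* B) (hflat : f.Flat)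
    (hsurj : Function.Surjective (PrimeSpectrum.comap f))
    (hB : IsRegularLocal B) : IsRegularLocal A := by
  obtain ⟨_, s, hs, hcard⟩ := hB
  have hregB : IsRegularLocalRing B := by
    apply IsRegularLocalRing.of_spanFinrank_maximalIdeal_le
    rw [← hcard, ← hs, ← Set.ncard_coe_finset]
    exact_mod_cast Submodule.spanFinrank_span_le_ncard_of_finite s.finite_toSet
  let _ := f.toAlgebra
  have : Module.FaithfullyFlat A B :=
    (RingHom.FaithfullyFlat.iff_flat_and_comap_surjective (f := f)).2 ⟨hflat, hsurj⟩
  obtain ⟨k, hk⟩ := IsRegularLocalRing.exists_hasPD_of_spanFinrank_le _ B le_rfl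
    (B ⊗[A] ResidueField A)
  have hregA := IsRegularLocalRing.of_hasPD_residueField_of_spanFinrank_le _ A le_rfl
    (HasPD.of_baseChange k (ResidueField A) hk)
  obtain ⟨t, ht, hspan⟩ := Submodule.FG.exists_span_finset_card_eq_spanFinrank
    (maximalIdeal A).fg_of_isNoetherianRing
  exact ⟨inferInstance, t, hspan, by rw [ht, IsRegularLocalRing.spanFinrank_maximalIdeal]⟩
end

section
/- Every connected reduced algebraic variety X (a scheme admitting a finite type morphism to the spectrum of some field) possesses a maximal ground field: there is a largest field k contained in O_X(X) such that X is of finite type over Spec k, and this k contains every field over which X is of finite type. -/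
universe u

open AlgebraicGeometry CategoryTheory

/-- A subring `k` of the ring of global functions of a scheme `X` is a *ground field*
of `X` if `k` is a field and the induced morphism `X ⟶ Spec k` is of finite type
(quasi-compact and locally of finite type). -/
def IsGroundField (X : Scheme.{u}) (k : Subring Γ(X, ⊤)) : Prop :=
  IsField k ∧
    LocallyOfFiniteType (X.toSpecΓ ≫ Spec.map (CommRingCat.ofHom k.subtype)) ∧
      QuasiCompact (X.toSpecΓ ≫ Spec.map (CommRingCat.ofHom k.subtype))

open Polynomial in
/-- A nonzero polynomial does not vanish at all roots of unity of an algebraically closed field. -/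
lemma Polynomial.exists_pow_eq_one_aeval_ne_zero {k : Type*} (L : Type*) [Field k] [Field L]
    [Algebra k L] [IsAlgClosed L] {g : k[X]} (hg : g ≠ 0) :
    ∃ (n : ℕ) (r : L), n ≠ 0 ∧ r ^ n = 1 ∧ aeval r g ≠ 0 := by
  obtain ⟨n, hn, hnk⟩ : ∃ n : ℕ, g.natDegree < n ∧ (n : k) ≠ 0 := by
    by_cases h : ((g.natDegree + 1 : ℕ) : k) = 0
    · refine ⟨g.natDegree + 2, by lia, ?_⟩
      have : ((g.natDegree + 2 : ℕ) : k) = ((g.natDegree + 1 : ℕ) : k) + 1 := by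
        push_cast; ring
      rw [this, h, zero_add]
      exact one_ne_zero
    · exact ⟨_, Nat.lt_succ_self _, h⟩
  have hn0 : n ≠ 0 := by lia
  have hcard := card_rootSet_eq_natDegree (K := L) (X_pow_sub_one_separable_iff.2 hnk)
    (IsAlgClosed.splits _)
  rw [← C_1, natDegree_X_pow_sub_C, ← Nat.card_eq_fintype_card, Nat.card_coe_set_eq] at hcard
  have hlt : (g.rootSet L).ncard < ((X ^ n - C 1 : k[X]).rootSet L).ncard :=
    (ncard_rootSet_le g L).trans_lt (hn.trans_eq hcard.symm)
  obtain ⟨r, hr, hrg⟩ := Set.exists_mem_notMem_of_ncard_lt_ncard hlt (rootSet_finite g L)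
  refine ⟨n, r, hn0, ?_, fun h ↦ hrg (mem_rootSet.2 ⟨hg, h⟩)⟩
  simpa [sub_eq_zero] using (mem_rootSet.1 hr).2

/-- The image of a dominant morphism of finite presentation to the spectrum of a domain contains
a nonempty basic open subset. -/
lemma PrimeSpectrum.exists_basicOpen_subset_range_comap {R S : Type*} [CommRing R] [IsDomain R]
    [CommRing S] {f : R →+* S} (hf : f.FinitePresentation) (hinj : Function.Injective f) :
    ∃ g : R, g ≠ 0 ∧ (basicOpen g : Set (PrimeSpectrum R)) ⊆ Set.range (comap f) := by
  have hbot : (⊥ : PrimeSpectrum R) ∈ Set.range (comap f) := by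
    refine (denseRange_comap_iff_minimalPrimes f).1
      ((denseRange_comap_iff_ker_le_nilRadical f).2 ?_) ⊥ ?_
    · rw [(RingHom.injective_iff_ker_eq_bot f).1 hinj]
      exact bot_le
    · simp [IsDomain.minimalPrimes_eq_singleton_bot]
  obtain ⟨s, hs⟩ := exists_constructibleSetData_iff.2 (isConstructible_range_comap hf)
  rw [← hs] at hbot ⊢
  simp only [ConstructibleSetData.toSet, Set.mem_iUnion] at hbot
  obtain ⟨C, hC, hCbot⟩ := hbot
  refine ⟨C.f, fun h ↦ hCbot.2 (by simp [h]), fun p hp ↦ ?_⟩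
  refine Set.mem_iUnion₂.2 ⟨C, hC, ?_, by simpa using hp⟩
  exact fun x hx ↦ by
    have := hCbot.1 hx
    simp only [SetLike.mem_coe, asIdeal_bot, Ideal.mem_bot] at this
    simp [this]

open Polynomial in
/-- In an algebra of finite type over a field `k`, an element `a` is algebraic over `k` as soon as
all elements `a ^ n - 1` are zero or invertible. -/
lemma isAlgebraic_of_forall_pow_sub_one {k A : Type*} [Field k] [CommRing A] [Algebra k A]
    [Algebra.FiniteType k A] {a : A} (h : ∀ n : ℕ, n ≠ 0 → a ^ n - 1 = 0 ∨ IsUnit (a ^ n - 1)) :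
    IsAlgebraic k a := by
  by_contra ha
  have hfin : (aeval (R := k) a).toRingHom.FiniteType :=
    RingHom.FiniteType.of_comp_finiteType (f := algebraMap k k[X])
      (by
        have := (RingHom.finiteType_algebraMap (A := k) (B := A)).2 inferInstance
        rwa [← (aeval (R := k) a).comp_algebraMap] at this)
  obtain ⟨g, hg, hrange⟩ := PrimeSpectrum.exists_basicOpen_subset_range_comap
    (RingHom.FinitePresentation.of_finiteType.1 hfin) (transcendental_iff_injective.1 ha)
  obtain ⟨n, r, hn, hr, hgr⟩ := exists_pow_eq_one_aeval_ne_zero (AlgebraicClosure k) hg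
  let p : PrimeSpectrum k[X] := ⟨RingHom.ker (aeval (R := k) r).toRingHom, RingHom.ker_isPrime _⟩
  obtain ⟨q, hq⟩ := hrange (show p ∈ _ from hgr)
  have hmem : (X ^ n - 1 : k[X]) ∈ p.asIdeal := by
    change aeval r (X ^ n - 1 : k[X]) = 0
    simp [hr]
  rw [← hq] at hmem
  have hmem' : a ^ n - 1 ∈ q.asIdeal := by simpa using hmem
  rcases h n hn with h0 | hu
  · exact ha ⟨X ^ n - C 1, X_pow_sub_C_ne_zero (Nat.pos_of_ne_zero hn) 1, by simpa using h0⟩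
  · exact q.2.ne_top (Ideal.eq_top_of_isUnit_mem _ hmem' hu)

/-- Algebraicity over a field can be checked after a finite jointly injective family of
homomorphisms. -/
lemma isAlgebraic_of_jointly_injective {k R ι : Type*} [Finite ι] [Field k] [CommRing R]
    [Algebra k R] {B : ι → Type*} [∀ i, CommRing (B i)] [∀ i, Algebra k (B i)]
    (g : ∀ i, R →ₐ[k] B i) (hg : ∀ x, (∀ i, g i x = 0) → x = 0) {a : R}
    (ha : ∀ i, IsAlgebraic k (g i a)) : IsAlgebraic k a := by
  cases nonempty_fintype ι
  choose p hp hpa using ha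
  refine ⟨∏ i, p i, Finset.prod_ne_zero_iff.2 fun i _ ↦ hp i, hg _ fun i ↦ ?_⟩
  rw [← Polynomial.aeval_algHom_apply, map_prod]
  exact Finset.prod_eq_zero (Finset.mem_univ i) (hpa i)

open Polynomial in
/-- In a reduced algebra over a field without nontrivial idempotents, the integral elements form
a field. -/
lemma isField_integralClosure_of_isReduced {k R : Type*} [Field k] [CommRing R] [Nontrivial R]
    [IsReduced R] [Algebra k R] (hidem : ∀ e : R, IsIdempotentElem e → e = 0 ∨ e = 1) :
    IsField (integralClosure k R) := by
  refine ⟨⟨0, 1, zero_ne_one⟩, mul_comm, ?_⟩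
  rintro ⟨a, ha⟩ ha0
  obtain ⟨p, hp, hpa⟩ := isAlgebraic_iff_isIntegral.2 ha
  obtain ⟨u, hu, hu0⟩ := exists_eq_pow_rootMultiplicity_mul_and_not_dvd p hp 0
  rw [C_0, sub_zero] at hu hu0
  have hau : a * aeval a u = 0 := by
    refine eq_zero_of_pow_eq_zero (n := rootMultiplicity 0 p + 1) ?_
    rw [hu, map_mul, map_pow, aeval_X] at hpa
    rw [mul_pow, pow_succ, pow_succ]
    linear_combination (a * aeval a u ^ rootMultiplicity 0 p) * hpa
  have hc : u.coeff 0 ≠ 0 := fun h ↦ hu0 (X_dvd_iff.2 h)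
  have hdecomp : aeval a u = a * aeval a u.divX + algebraMap k R (u.coeff 0) := by
    conv_lhs => rw [← divX_mul_X_add u]
    simp only [map_add, map_mul, aeval_X, aeval_C]
    ring
  set w : R := algebraMap k R (-(u.coeff 0)⁻¹) * aeval a u.divX with hw
  have hwint : IsIntegral k w :=
    isIntegral_algebraMap.mul
      (Algebra.adjoin_singleton_le (S := integralClosure k R) ha (aeval_mem_adjoin_singleton k a))
  have hinv : algebraMap k R (u.coeff 0) * algebraMap k R (-(u.coeff 0)⁻¹) = -1 := by
    rw [← map_mul, mul_neg, mul_inv_cancel₀ hc, map_neg, map_one]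
  have haw : a * (a * w) = a := by
    rw [hdecomp] at hau
    rw [hw]
    linear_combination algebraMap k R (-(u.coeff 0)⁻¹) * hau - a * hinv
  refine ⟨⟨w, hwint⟩, Subtype.ext ?_⟩
  rcases hidem (a * w) (by rw [IsIdempotentElem]; linear_combination w * haw) with h | h
  · refine absurd (Subtype.ext (?_ : a = 0)) ha0
    rw [← haw, h, mul_zero]
  · exact h

namespace AlgebraicGeometry

/-- The global functions of a connected reduced scheme have only trivial idempotents. -/
lemma eq_zero_or_eq_one_of_isIdempotentElem {X : Scheme.{u}} [IsReduced X] [PreconnectedSpace X]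
    {e : Γ(X, ⊤)} (he : IsIdempotentElem e) : e = 0 ∨ e = 1 := by
  have hinf : X.basicOpen e ⊓ X.basicOpen (1 - e) = ⊥ := by
    rw [← Scheme.basicOpen_mul, he.mul_one_sub_self]
    simp
  have hsup : X.basicOpen e ⊔ X.basicOpen (1 - e) = ⊤ := by
    refine top_le_iff.1 ?_
    have := X.basicOpen_add_le e (1 - e)
    simpa using this
  have hclopen : IsClopen (X.basicOpen e : Set X) := by
    refine ⟨⟨?_⟩, (X.basicOpen e).2⟩
    have : IsCompl (X.basicOpen e : Set X) (X.basicOpen (1 - e)) := by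
      refine IsCompl.of_eq ?_ ?_
      · simpa using congr_arg SetLike.coe hinf
      · simpa using congr_arg SetLike.coe hsup
    rw [this.compl_eq]
    exact (X.basicOpen (1 - e)).2
  rcases isClopen_iff.1 hclopen with h | h
  · exact .inl (eq_zero_of_basicOpen_eq_bot e (TopologicalSpace.Opens.ext h))
  · have h' : X.basicOpen e = ⊤ := TopologicalSpace.Opens.ext h
    rw [h', top_inf_eq] at hinf
    exact .inr (sub_eq_zero.1 (eq_zero_of_basicOpen_eq_bot _ hinf)).symm

/-- A global function on a scheme of finite type over a field `k` is algebraic over `k` if it lies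
in a subring of the ring of global functions that is a field. -/
lemma isAlgebraic_of_mem_isField {X : Scheme.{u}} [CompactSpace X] {k : Type u} [Field k]
    [Algebra k Γ(X, ⊤)]
    [LocallyOfFiniteType (X.toSpecΓ ≫ Spec.map (CommRingCat.ofHom (algebraMap k Γ(X, ⊤))))]
    {F : Subring Γ(X, ⊤)} (hF : IsField F) {a : Γ(X, ⊤)} (ha : a ∈ F) : IsAlgebraic k a := by
  let 𝒰 := X.affineCover.finiteSubcover
  let ψ (i : 𝒰.I₀) : Γ(X, ⊤) →+* Γ(𝒰.X i, ⊤) := ((𝒰.f i).appTop).hom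
  let (i : 𝒰.I₀) : Algebra k Γ(𝒰.X i, ⊤) := ((ψ i).comp (algebraMap k Γ(X, ⊤))).toAlgebra
  have hfin (i : 𝒰.I₀) : Algebra.FiniteType k Γ(𝒰.X i, ⊤) := by
    have h : LocallyOfFiniteType (inv (𝒰.X i).toSpecΓ ≫ 𝒰.f i ≫ X.toSpecΓ ≫
      Spec.map (CommRingCat.ofHom (algebraMap k Γ(X, ⊤)))) := inferInstance
    rw [Scheme.toSpecΓ_naturality_assoc, IsIso.inv_hom_id_assoc, ← Spec.map_comp,
      HasRingHomProperty.Spec_iff (P := @LocallyOfFiniteType)] at h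
    exact h
  refine isAlgebraic_of_jointly_injective (B := fun i ↦ Γ(𝒰.X i, ⊤))
    (fun i ↦ { ψ i with commutes' := fun _ ↦ rfl }) (fun x hx ↦ ?_) fun i ↦ ?_
  · exact Scheme.zero_of_zero_cover x 𝒰 hx
  · refine isAlgebraic_of_forall_pow_sub_one fun n _ ↦ ?_
    let b : F := ⟨a, ha⟩ ^ n - 1
    have hb : ψ i b = ψ i a ^ n - 1 := by simp [b]
    change ψ i a ^ n - 1 = 0 ∨ IsUnit (ψ i a ^ n - 1)
    rw [← hb]
    by_cases h0 : b = 0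
    · simp [h0]
    · obtain ⟨c, hc⟩ := hF.mul_inv_cancel h0
      refine .inr ((IsUnit.of_mul_eq_one (c : Γ(X, ⊤)) ?_).map (ψ i))
      exact congr_arg Subtype.val hc

end AlgebraicGeometry

/-- Every connected reduced algebraic variety `X` (a scheme admitting a finite type
morphism to the spectrum of some field) possesses a maximal ground field: a largest
field `k ⊆ O_X(X)` over which `X` is of finite type, containing every field over which
`X` is of finite type. -/
theorem exists_maximal_groundField (X : Scheme.{u}) [IsReduced X] [ConnectedSpace X]
    (hvar : ∃ (k₀ : Type u) (_ : Field k₀) (f : X ⟶ Spec (CommRingCat.of k₀)),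
      LocallyOfFiniteType f ∧ QuasiCompact f) :
    ∃ k : Subring Γ(X, ⊤), IsGroundField X k ∧
      ∀ k' : Subring Γ(X, ⊤), IsGroundField X k' → k' ≤ k := by
  obtain ⟨k₀, _, f, hf, hqc⟩ := hvar
  have : CompactSpace X := (quasiCompact_iff_compactSpace f).1 hqc
  let φ : CommRingCat.of k₀ ⟶ Γ(X, ⊤) := (Scheme.ΓSpecIso (.of k₀)).inv ≫ f.appTop
  let : Algebra k₀ Γ(X, ⊤) := φ.hom.toAlgebra
  have hfac : f = X.toSpecΓ ≫ Spec.map (CommRingCat.ofHom (algebraMap k₀ Γ(X, ⊤))) := by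
    change f = X.toSpecΓ ≫ Spec.map φ
    simp [φ, ← Scheme.toSpecΓ_naturality_assoc]
  rw [hfac] at hf
  have : Nonempty (⊤ : X.Opens) := ⟨⟨Classical.arbitrary X, trivial⟩⟩
  let K := integralClosure k₀ Γ(X, ⊤)
  refine ⟨K.toSubring, ⟨?_, ?_, ?_⟩, fun k' hk' a ha ↦ ?_⟩
  · exact isField_integralClosure_of_isReduced fun _ ↦ eq_zero_or_eq_one_of_isIdempotentElem
  · have hcomp : X.toSpecΓ ≫ Spec.map (CommRingCat.ofHom (algebraMap k₀ Γ(X, ⊤))) =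
        (X.toSpecΓ ≫ Spec.map (CommRingCat.ofHom K.toSubring.subtype)) ≫
          Spec.map (CommRingCat.ofHom (algebraMap k₀ K)) := by
      rw [Category.assoc, ← Spec.map_comp]
      rfl
    rw [hcomp] at hf
    exact locallyOfFiniteType_of_comp _ (Spec.map (CommRingCat.ofHom (algebraMap k₀ K)))
  · exact (quasiCompact_iff_compactSpace _).2 ‹_›
  · exact isAlgebraic_iff_isIntegral.1 (isAlgebraic_of_mem_isField hk'.1 ha)
end
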